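/- Let A be a 2×2 real matrix with determinant 1 and |trace A| > 2, and let V be a finite set of nonzero vectors in ℝ², none of which is an eigenvector of A. Then there exists a natural number n ≥ 1 such that for all v, w ∈ V, the vectors A^n·v and w are linearly independent over ℝ. -/

import Mathlib

open Matrix

lemma pow_form (A : Matrix (Fin 2) (Fin 2) ℝ)
    (hdet : A.det = 1) (htr : |Matrix.trace A| > 2) (d : ℕ) :
    ∃ s t : ℝ, A ^ (d + 1) = s • A - t • (1 : Matrix (Fin 2) (Fin 2) ℝ) ∧ |t| < |s| := by
  induction d with
  | zero => exact ⟨1, 0, by simp, by simp⟩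
  | succ d ih =>
    obtain ⟨s, t, h, hlt⟩ := ih
    refine ⟨A.trace * s - t, s, ?_, ?_⟩
    · have hA : A * A = A.trace • A - (1 : Matrix (Fin 2) (Fin 2) ℝ) := by
        rw [Matrix.det_fin_two] at hdet
        ext i j
        fin_cases i <;> fin_cases j <;>
          simp [Matrix.mul_apply, Fin.sum_univ_two, Matrix.trace_fin_two] <;> linarith
      rw [pow_succ, h, sub_mul, smul_mul_assoc, hA, smul_mul_assoc, one_mul]
      module
    · have h1 : |A.trace * s| - |t| ≤ |A.trace * s - t| := abs_sub_abs_le_abs_sub _ _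
      rw [abs_mul] at h1
      nlinarith [abs_nonneg s, abs_nonneg t]

lemma no_pow_eig (A : Matrix (Fin 2) (Fin 2) ℝ)
    (hdet : A.det = 1) (htr : |Matrix.trace A| > 2) (v : Fin 2 → ℝ)
    (hv : ∀ lam : ℝ, A.mulVec v ≠ lam • v) (d : ℕ) (c : ℝ) :
    (A ^ (d + 1)).mulVec v ≠ c • v := by
  intro hc
  obtain ⟨s, t, h, hlt⟩ := pow_form A hdet htr d
  have hs : s ≠ 0 := by
    rintro rfl
    simp at hlt
    linarith [abs_nonneg t]
  rw [h, Matrix.sub_mulVec, Matrix.smul_mulVec, Matrix.smul_mulVec, Matrix.one_mulVec] at hc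
  apply hv (s⁻¹ * (c + t))
  rw [mul_smul, add_smul, ← hc, sub_add_cancel, smul_smul, inv_mul_cancel₀ hs, one_smul]

/-- For a hyperbolic `A ∈ SL(2, ℝ)` (determinant `1`, `|trace| > 2`) and a
finite set `V` of nonzero vectors none of which is an eigenvector of `A`,
there is `n ≥ 1` such that for all `v, w ∈ V`, the vectors `Aⁿ·v` and `w`
are linearly independent. -/
theorem exists_power_linearIndependent
    (A : Matrix (Fin 2) (Fin 2) ℝ)
    (hdet : A.det = 1) (htr : |Matrix.trace A| > 2)
    (V : Finset (Fin 2 → ℝ)) (hV0 : ∀ v ∈ V, v ≠ 0)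
    (hVeig : ∀ v ∈ V, ∀ lam : ℝ, A.mulVec v ≠ lam • v) :
    ∃ n : ℕ, 1 ≤ n ∧ ∀ v ∈ V, ∀ w ∈ V,
      LinearIndependent ℝ ![(A ^ n).mulVec v, w] := by
  have hinj : ∀ n : ℕ, Function.Injective (A ^ n).mulVec := fun n =>
    Matrix.mulVec_injective_of_isUnit
      (((Matrix.isUnit_iff_isUnit_det A).2 (by simp [hdet])).pow n)
  have key : ∀ v ∈ V, ∀ w ∈ V, ∀ n m : ℕ, n < m → ∀ a b : ℝ,
      a • (A ^ n).mulVec v = w → b • (A ^ m).mulVec v = w → False := by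
    intro v hv w hw n m hnm a b ha hb
    obtain ⟨d, rfl⟩ : ∃ d, m = n + (d + 1) := ⟨m - n - 1, by omega⟩
    have hb0 : b ≠ 0 := by
      rintro rfl
      exact hV0 w hw (by rw [← hb, zero_smul])
    apply no_pow_eig A hdet htr v (hVeig v hv) d (b⁻¹ * a)
    apply hinj n
    rw [Matrix.mulVec_mulVec, ← pow_add, Matrix.mulVec_smul, mul_smul, ha, ← hb, smul_smul,
      inv_mul_cancel₀ hb0, one_smul]
  have hfin : (⋃ v ∈ V, ⋃ w ∈ V,
      {n : ℕ | ∃ a : ℝ, a • (A ^ n).mulVec v = w}).Finite := by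
    refine V.finite_toSet.biUnion fun v hv => V.finite_toSet.biUnion fun w hw => ?_
    apply Set.Subsingleton.finite
    rintro n ⟨a, ha⟩ m ⟨b, hb⟩
    rcases lt_trichotomy n m with h | h | h
    · exact (key v hv w hw n m h a b ha hb).elim
    · exact h
    · exact (key v hv w hw m n h b a hb ha).elim
  obtain ⟨n, hn⟩ := (hfin.union (Set.finite_singleton 0)).exists_notMem
  simp only [Set.mem_union, Set.mem_iUnion, Set.mem_setOf_eq, Set.mem_singleton_iff, not_or,
    not_exists] at hn
  refine ⟨n, by omega, fun v hv w hw => ?_⟩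
  have h0 : (A ^ n).mulVec v ≠ 0 := fun h =>
    hV0 v hv (hinj n (by rw [h, Matrix.mulVec_zero]))
  exact (LinearIndependent.pair_iff' h0).2 fun a => hn.1 v hv w hw a
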